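/- The series Σ_{j=26}^∞ a_j²·ω_{j+1} converges and its sum is strictly less than 4·a₂₅²·ω₂₆. (The tail upper bound in the proof of inequality (4.5) of Proposition 3.3.) -/

import Mathlib

open Finset

/-- The weights `ω_k = (2k choose k)/4^k`. -/
noncomputable def ω : ℕ → ℝ :=
  fun k => (Nat.choose (2 * k) k : ℝ) / 4 ^ k

/-- Maclaurin coefficients of `F(z) = (1 - √(2/3) z)^(-5/2)`. -/
noncomputable def a : ℕ → ℝ :=
  fun j => ∏ t ∈ Finset.Icc 1 j, (Real.sqrt (2 / 3) * (1 + 3 / (2 * (t : ℝ))))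

noncomputable def S₁ : ℝ :=
  Real.sqrt (2 / 3) * ∑ j ∈ Finset.range 25, (1 + 3 / (2 * ((j : ℝ) + 1))) * (a j) ^ 2 * ω (j + 1)

noncomputable def S₂ : ℝ :=
  ∑ j ∈ Finset.range 25, (a j) ^ 2 * ω (j + 1)

noncomputable def S₃ : ℝ :=
  (5 - Real.sqrt 6) * (a 25) ^ 2 * ω 26

noncomputable def S₄ : ℝ :=
  ∑ j ∈ Finset.range 25, (a j) ^ 2 * ω (j + 1) / ((j : ℝ) + 1)

theorem omega_pos_aux (n : ℕ) : 0 < ω n := by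
  have := Nat.centralBinom_pos n
  rw [Nat.centralBinom_eq_two_mul_choose] at this
  unfold ω
  positivity

theorem omega_succ_le (n : ℕ) : ω (n + 1) ≤ ω n := by
  have h := Nat.succ_mul_centralBinom_succ n
  have h' : (n + 1) * Nat.centralBinom (n + 1) ≤ (n + 1) * (4 * Nat.centralBinom n) := by
    rw [h]; nlinarith [Nat.zero_le (Nat.centralBinom n)]
  have h2 := Nat.le_of_mul_le_mul_left h' (Nat.succ_pos n)
  rw [Nat.centralBinom_eq_two_mul_choose, Nat.centralBinom_eq_two_mul_choose] at h2
  have h3 : ((Nat.choose (2 * (n + 1)) (n + 1) : ℕ) : ℝ) ≤ 4 * (Nat.choose (2 * n) n : ℕ) := by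
    exact_mod_cast h2
  unfold ω
  rw [div_le_div_iff₀ (by positivity) (by positivity), pow_succ]
  have : (0 : ℝ) < 4 ^ n := by positivity
  nlinarith

theorem a_sq_succ_le (j : ℕ) (hj : 25 ≤ j) : (a (j + 1)) ^ 2 ≤ 3 / 4 * (a j) ^ 2 := by
  have h : a (j + 1) = a j * (Real.sqrt (2 / 3) * (1 + 3 / (2 * ((j + 1 : ℕ) : ℝ)))) := by
    unfold a
    rw [Finset.prod_Icc_succ_top (by omega)]
  have hs : Real.sqrt (2 / 3) ^ 2 = 2 / 3 := Real.sq_sqrt (by norm_num)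
  have hj' : (26 : ℝ) ≤ ((j + 1 : ℕ) : ℝ) := by exact_mod_cast (by omega : 26 ≤ j + 1)
  have h1 : 3 / (2 * ((j + 1 : ℕ) : ℝ)) ≤ 3 / 52 := by
    apply div_le_div_of_nonneg_left <;> linarith
  have h0 : 0 ≤ 3 / (2 * ((j + 1 : ℕ) : ℝ)) := by positivity
  rw [h, mul_pow, mul_pow, hs, mul_comm]
  apply mul_le_mul_of_nonneg_right _ (sq_nonneg _)
  nlinarith

theorem term_bound (j : ℕ) :
    (a (j + 26)) ^ 2 * ω (j + 26 + 1) ≤ (3 / 4 * ((a 25) ^ 2 * ω 26)) * (3 / 4) ^ j := by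
  have key : ∀ k, 25 ≤ k →
      (a (k + 1)) ^ 2 * ω (k + 1 + 1) ≤ 3 / 4 * ((a k) ^ 2 * ω (k + 1)) := by
    intro k hk
    rw [← mul_assoc]
    exact mul_le_mul (a_sq_succ_le k hk) (omega_succ_le _) (omega_pos_aux _).le (by positivity)
  induction j with
  | zero => simpa using key 25 le_rfl
  | succ j ih =>
    have := key (j + 26) (by omega)
    rw [show j + 1 + 26 = j + 26 + 1 by omega, pow_succ (3 / 4 : ℝ) j]
    linarith

theorem a_pos_aux (j : ℕ) : 0 < a j := by
  unfold a
  apply Finset.prod_pos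
  intro t _
  positivity

/-- Tail upper bound in the proof of (4.5): `Σ_{j=26}^∞ a_j² ω_{j+1} < 4 a₂₅² ω₂₆`. -/
theorem tail_upper_bound :
    Summable (fun j : ℕ => (a (j + 26)) ^ 2 * ω (j + 26 + 1)) ∧
    (∑' j : ℕ, (a (j + 26)) ^ 2 * ω (j + 26 + 1)) < 4 * (a 25) ^ 2 * ω 26 := by
  have hg : Summable (fun j : ℕ => (3 / 4 * ((a 25) ^ 2 * ω 26)) * (3 / 4 : ℝ) ^ j) :=
    (summable_geometric_of_lt_one (by norm_num) (by norm_num)).mul_left _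
  have hsum : Summable (fun j : ℕ => (a (j + 26)) ^ 2 * ω (j + 26 + 1)) :=
    Summable.of_nonneg_of_le
      (fun j => mul_nonneg (sq_nonneg _) (omega_pos_aux _).le) term_bound hg
  refine ⟨hsum, ?_⟩
  have h := hsum.tsum_le_tsum term_bound hg
  rw [tsum_mul_left, tsum_geometric_of_lt_one (by norm_num) (by norm_num)] at h
  have hp : 0 < (a 25) ^ 2 * ω 26 := mul_pos (pow_pos (a_pos_aux _) 2) (omega_pos_aux _)
  norm_num at h
  linarith
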